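/- Let X ⊆ S^n be a closed set not contained in any open hemisphere, and let X₀ = {p, −p} be a pair of antipodal points. Then for every ε > 0, σ(X_ε) ≥ σ((X₀)_ε), where Y_ε denotes the closed ε-neighborhood of Y in the geodesic metric and σ is the standard measure on S^n. Equivalently, σ(X_ε) ≥ 2 σ(B(ε)) where B(ε) is a spherical ball of radius ε. -/

import Mathlib

open MeasureTheory RealInnerProductSpace

/-- Geodesic distance between two points of the unit sphere in Euclidean space. -/
noncomputable def geodist {n : ℕ} (x y : EuclideanSpace ℝ (Fin n)) : ℝ :=
  Real.arccos ⟪x, y⟫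

section helpers
variable {E : Type*} [NormedAddCommGroup E] [InnerProductSpace ℝ E] [FiniteDimensional ℝ E]

/-- The stabilizer of `x` in the orthogonal group. -/
noncomputable def stabGroup [CompleteSpace E] (x : E) : Subgroup (unitary (E →L[ℝ] E)) where
  carrier := {g | (g : E →L[ℝ] E) x = x}
  one_mem' := by simp
  mul_mem' := by
    intro a b ha hb
    simp only [Set.mem_ofPred_eq] at *
    simp [hb, ha]
  inv_mem' := by
    intro a ha
    simp only [Set.mem_ofPred_eq] at *
    have h : ((a⁻¹ * a : unitary (E →L[ℝ] E)) : E →L[ℝ] E) x = x := by simp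
    rw [Submonoid.coe_mul, mul_apply_eq_comp, ha] at h
    exact h

lemma stabGroup_compact [CompleteSpace E] (x : E) : CompactSpace (stabGroup x) := by
  have : ProperSpace (E →L[ℝ] E) := FiniteDimensional.proper ℝ _
  have hU : IsCompact (unitary (E →L[ℝ] E) : Set (E →L[ℝ] E)) := by
    apply Metric.isCompact_of_isClosed_isBounded isClosed_unitary
    rw [Metric.isBounded_iff_subset_closedBall 0]
    refine ⟨1, fun u hu => ?_⟩
    rw [mem_closedBall_zero_iff]
    refine ContinuousLinearMap.opNorm_le_bound _ zero_le_one (fun z => ?_)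
    have h := (Unitary.linearIsometryEquiv ⟨u, hu⟩).norm_map z
    have h2 : (Unitary.linearIsometryEquiv ⟨u, hu⟩) z = u z := rfl
    rw [← h2, h, one_mul]
  have : CompactSpace (unitary (E →L[ℝ] E)) := isCompact_iff_compactSpace.mp hU
  have hc : IsClosed (stabGroup x : Set (unitary (E →L[ℝ] E))) := by
    change IsClosed {g : unitary (E →L[ℝ] E) | (g : E →L[ℝ] E) x = x}
    apply isClosed_eq _ continuous_const
    fun_prop
  exact isCompact_iff_compactSpace.mp hc.isCompact

/-- averaging over the stabilizer of `x` -/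
lemma averaging [MeasurableSpace E] [BorelSpace E] (σ : Measure E) [IsFiniteMeasure σ]
    (hinv : ∀ g : E ≃ₗᵢ[ℝ] E, ∀ s, MeasurableSet s → σ (g ⁻¹' s) = σ s)
    (x : E) (A : Set E) (hA : MeasurableSet A) :
    ∃ φ : E → ENNReal, Measurable φ ∧ (∀ g : E ≃ₗᵢ[ℝ] E, g x = x → ∀ z, φ (g z) = φ z) ∧
      (∀ z w, (∀ g : E ≃ₗᵢ[ℝ] E, g x = x → g z ∈ A → g w ∈ A) → φ z ≤ φ w) ∧
      ∀ D, MeasurableSet D → (∀ g : E ≃ₗᵢ[ℝ] E, g x = x → ∀ z, (g z ∈ D ↔ z ∈ D)) →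
        ∫⁻ z in D, φ z ∂σ = σ (A ∩ D) := by
  have : CompleteSpace E := FiniteDimensional.complete ℝ E
  have := stabGroup_compact x
  let : MeasurableSpace (stabGroup x) := borel _
  have : BorelSpace (stabGroup x) := ⟨rfl⟩
  let m : Measure (stabGroup x) := Measure.haarMeasure ⊤
  have hm : m Set.univ = 1 := by
    have := Measure.haarMeasure_self (G := stabGroup x) (K₀ := ⊤)
    simpa using this
  have : IsProbabilityMeasure m := ⟨hm⟩
  let act : stabGroup x → E → E := fun g z => ((g⁻¹ : stabGroup x) : unitary (E →L[ℝ] E)).1 z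
  let iso : stabGroup x → E ≃ₗᵢ[ℝ] E := fun g =>
    Unitary.linearIsometryEquiv ((g⁻¹ : stabGroup x) : unitary (E →L[ℝ] E))
  have hiso : ∀ g z, iso g z = act g z := fun g z => rfl
  have hfix : ∀ g, iso g x = x := fun g => (g⁻¹).2
  have hcont : Continuous (fun q : stabGroup x × E => act q.1 q.2) := by
    have h1 : Continuous (fun q : stabGroup x × E =>
      (((q.1⁻¹ : stabGroup x) : unitary (E →L[ℝ] E)) : E →L[ℝ] E)) := by fun_prop
    exact h1.clm_apply continuous_snd
  have hmeas : ∀ s, MeasurableSet s → MeasurableSet {q : stabGroup x × E | act q.1 q.2 ∈ s} :=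
    fun s hs => hcont.measurable hs
  refine ⟨fun z => m {g | act g z ∈ A}, measurable_measure_prodMk_right (hmeas A hA), ?_, ?_, ?_⟩
  · intro g hg z
    let h : stabGroup x := ⟨Unitary.linearIsometryEquiv.symm g, hg⟩
    have hh : {k | act k (g z) ∈ A} = (fun k => h⁻¹ * k) ⁻¹' {k | act k z ∈ A} := by
      ext k
      simp only [Set.mem_ofPred_eq, Set.mem_preimage, act, mul_inv_rev, inv_inv]
      rfl
    simp only [hh]
    exact measure_preimage_mul m h⁻¹ _
  · intro z w hzw
    exact measure_mono fun g hg => hzw (iso g) (hfix g) hg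
  · intro D hD hDinv
    have h1 := Measure.prod_apply (μ := m) (ν := σ) (hmeas _ (hA.inter hD))
    have h2 := Measure.prod_apply_symm (μ := m) (ν := σ) (hmeas _ (hA.inter hD))
    have h3 : ∀ g, σ (Prod.mk g ⁻¹' {q : stabGroup x × E | act q.1 q.2 ∈ A ∩ D}) = σ (A ∩ D) :=
      fun g => hinv (iso g) _ (hA.inter hD)
    simp only [h3, lintegral_const, hm, mul_one] at h1
    rw [← h1, h2, ← lintegral_indicator hD]
    congr 1
    ext z
    by_cases hz : z ∈ D
    · rw [Set.indicator_of_mem hz]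
      congr 1
      ext g
      simp only [Set.mem_ofPred_eq, Set.mem_preimage, Set.mem_inter_iff]
      exact ⟨fun h => ⟨h, (hDinv (iso g) (hfix g) z).2 hz⟩, fun h => h.1⟩
    · rw [Set.indicator_of_notMem hz]
      symm
      convert measure_empty (μ := m)
      ext g
      simp only [Set.mem_ofPred_eq, Set.mem_preimage, Set.mem_inter_iff, Set.mem_empty_iff_false,
        iff_false]
      exact fun h => hz ((hDinv (iso g) (hfix g) z).1 h.2)

/-- an isometry fixing `x` and moving `z` to `w` -/
lemma exists_iso {x z w : E} (hn : ‖z‖ = ‖w‖) (hx : ⟪x, z⟫ = ⟪x, w⟫) :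
    ∃ g : E ≃ₗᵢ[ℝ] E, g x = x ∧ g z = w := by
  refine ⟨(ℝ ∙ (z - w))ᗮ.reflection, ?_, Submodule.reflection_sub hn⟩
  rw [Submodule.reflection_eq_self_iff, Submodule.mem_orthogonal_singleton_iff_inner_left,
    inner_sub_right, hx, sub_self]

lemma sphere_trans {z w : E} (hn : ‖z‖ = ‖w‖) : ∃ g : E ≃ₗᵢ[ℝ] E, g z = w := by
  obtain ⟨g, -, h⟩ := exists_iso (x := (0 : E)) hn (by simp)
  exact ⟨g, h⟩

def cap (x : E) (c : ℝ) : Set E := {z | ‖z‖ = 1 ∧ c ≤ ⟪x, z⟫}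

lemma cap_closed (x : E) (c : ℝ) : IsClosed (cap x c) := by
  have h1 : IsClosed {z : E | ‖z‖ = 1} := isClosed_eq continuous_norm continuous_const
  have h2 : IsClosed {z : E | c ≤ ⟪x, z⟫} :=
    isClosed_le continuous_const (continuous_const.inner continuous_id)
  exact h1.inter h2

lemma exists_geod_between {x z : E} {t : ℝ} (hx : ‖x‖ = 1) (hz : ‖z‖ = 1) (ht0 : 0 ≤ t) (ht1 : t ≤ 1)
    (hz1 : -1 < ⟪x, z⟫) (hzt : ⟪x, z⟫ < t) : ∃ a b : ℝ, 0 ≤ a ∧ 0 ≤ b ∧ ‖a • z + b • x‖ = 1 ∧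
      ⟪x, a • z + b • x⟫ = t := by
  set r := ⟪x, z⟫ with hr
  have hr2 : 0 < 1 - r ^ 2 := by nlinarith
  have ht2 : 0 ≤ 1 - t ^ 2 := by nlinarith
  obtain ⟨a, ha, hasq⟩ : ∃ a : ℝ, 0 ≤ a ∧ a ^ 2 * (1 - r ^ 2) = 1 - t ^ 2 := by
    refine ⟨√((1 - t ^ 2) / (1 - r ^ 2)), Real.sqrt_nonneg _, ?_⟩
    rw [Real.sq_sqrt (by positivity)]
    field_simp
  have hinn : ⟪x, a • z + (t - a * r) • x⟫ = t := by
    rw [inner_add_right, inner_smul_right, inner_smul_right, real_inner_self_eq_norm_sq, hx, ← hr]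
    ring
  have hnorm : ‖a • z + (t - a * r) • x‖ = 1 := by
    have h : ‖a • z + (t - a * r) • x‖ ^ 2 = 1 := by
      rw [norm_add_sq_real, norm_smul, norm_smul, inner_smul_left, inner_smul_right,
        real_inner_comm, ← hr, hx, hz, mul_one, mul_one, Real.norm_eq_abs, Real.norm_eq_abs,
        sq_abs, sq_abs]
      simp only [conj_trivial]
      linear_combination hasq
    nlinarith [norm_nonneg (a • z + (t - a * r) • x)]
  refine ⟨a, t - a * r, ha, ?_, hnorm, hinn⟩
  rcases le_or_gt r 0 with h | h
  · nlinarith [mul_nonneg ha (neg_nonneg.2 h)]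
  · have : a ≤ 1 := by
      by_contra hcon
      push Not at hcon
      have h1 : 1 < a ^ 2 := by nlinarith
      have h2 := mul_lt_mul_of_pos_right h1 hr2
      nlinarith
    nlinarith

lemma star_ineq [MeasurableSpace E] [BorelSpace E] (σ : Measure E) [IsFiniteMeasure σ]
    (hinv : ∀ g : E ≃ₗᵢ[ℝ] E, ∀ s, MeasurableSet s → σ (g ⁻¹' s) = σ s)
    {x : E} (hx : ‖x‖ = 1) {A : Set E} (hA : MeasurableSet A) {c d : ℝ} (hc : 0 ≤ c) (hd : -1 < d) (hdc : d ≤ c)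
    (hAd : A ⊆ cap x d)
    (hstar : ∀ z ∈ A, ∀ a b : ℝ, 0 ≤ a → 0 ≤ b → ‖a • z + b • x‖ = 1 → a • z + b • x ∈ A) :
    σ A * σ (cap x c) ≤ σ (A ∩ cap x c) * σ (cap x d) := by
  obtain ⟨φ, hφ, hφinv, hφmono, hint⟩ := averaging σ hinv x A hA
  have hcapinv : ∀ c, ∀ g : E ≃ₗᵢ[ℝ] E, g x = x → ∀ z, (g z ∈ cap x c ↔ z ∈ cap x c) := by
    intro c g hg z
    have : ⟪x, g z⟫ = ⟪x, z⟫ := by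
      conv_lhs => rw [← hg]
      exact g.inner_map_map x z
    simp [cap, this]
  have hm : ∀ c, MeasurableSet (cap x c) := fun c => (cap_closed x c).measurableSet
  have hsub : cap x c ⊆ cap x d := fun z hz => ⟨hz.1, hdc.trans hz.2⟩
  have hB := hint _ (hm c) (hcapinv c)
  have hR := hint (cap x d \ cap x c) ((hm d).diff (hm c)) (by
    intro g hg z
    simp only [Set.mem_sdiff, hcapinv _ g hg])
  have hmono : ∀ z ∈ cap x c, ∀ w ∈ cap x d \ cap x c, φ w ≤ φ z := by
    intro z hz w hw
    have hwt : ⟪x, w⟫ < ⟪x, z⟫ := by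
      have : ⟪x, w⟫ < c := by
        by_contra h
        exact hw.2 ⟨hw.1.1, not_lt.1 h⟩
      exact this.trans_le hz.2
    have hz1 : ⟪x, z⟫ ≤ 1 := by
      have := real_inner_le_norm x z
      rwa [hx, hz.1, one_mul] at this
    obtain ⟨a, b, ha, hb, h1, h2⟩ := exists_geod_between hx hw.1.1 (hc.trans hz.2) hz1
      (hd.trans_le hw.1.2) hwt
    obtain ⟨g, hg, hgz⟩ := exists_iso (x := x) (z := a • w + b • x) (w := z) (h1.trans hz.1.symm) h2
    rw [← hgz, hφinv g hg]
    apply hφmono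
    intro k hk hkw
    have := hstar _ hkw a b ha hb
    have e : k (a • w + b • x) = a • k w + b • x := by simp [hk]
    rw [e]
    apply this
    rw [← e, k.norm_map, h1]
  set s : ENNReal := ⨆ w ∈ cap x d \ cap x c, φ w
  have i1 : ∫⁻ z in cap x d \ cap x c, φ z ∂σ ≤ s * σ (cap x d \ cap x c) := by
    rw [← setLIntegral_const]
    exact setLIntegral_mono' ((hm d).diff (hm c)) fun w hw => le_iSup₂ (f := fun w _ => φ w) w hw
  have i2 : s * σ (cap x c) ≤ ∫⁻ z in cap x c, φ z ∂σ := by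
    rw [← setLIntegral_const]
    exact setLIntegral_mono' (hm c) fun z hz => iSup₂_le fun w hw => hmono z hz w hw
  rw [hR] at i1
  rw [hB] at i2
  have e1 : σ A = σ (A ∩ cap x c) + σ (A ∩ (cap x d \ cap x c)) := by
    rw [← measure_inter_add_sdiff A (hm c)]
    congr 2
    ext z
    constructor
    · exact fun h => ⟨h.1, hAd h.1, h.2⟩
    · exact fun h => ⟨h.1, h.2.2⟩
  have e2 : σ (cap x d) = σ (cap x c) + σ (cap x d \ cap x c) := by
    rw [← measure_inter_add_sdiff (cap x d) (hm c), Set.inter_eq_self_of_subset_right hsub]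
  rw [e1, e2, add_mul, mul_add]
  refine add_le_add le_rfl ?_
  calc σ (A ∩ (cap x d \ cap x c)) * σ (cap x c) ≤ s * σ (cap x d \ cap x c) * σ (cap x c) := by
        gcongr
    _ = s * σ (cap x c) * σ (cap x d \ cap x c) := by ring
    _ ≤ _ := by gcongr

lemma cap_measure_eq [MeasurableSpace E] [BorelSpace E] (σ : Measure E)
    (hinv : ∀ g : E ≃ₗᵢ[ℝ] E, ∀ s, MeasurableSet s → σ (g ⁻¹' s) = σ s)
    {x p : E} (hx : ‖x‖ = 1) (hp : ‖p‖ = 1) (c : ℝ) : σ (cap x c) = σ (cap p c) := by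
  obtain ⟨g, hg⟩ := sphere_trans (hx.trans hp.symm)
  rw [← hinv g _ (cap_closed p c).measurableSet]
  congr 1
  ext z
  simp [cap, ← hg]

lemma finite_cover [MeasurableSpace E] [BorelSpace E] (σ : Measure E) [IsFiniteMeasure σ]
    (hinv : ∀ g : E ≃ₗᵢ[ℝ] E, ∀ s, MeasurableSet s → σ (g ⁻¹' s) = σ s)
    (F : Finset E) (hF : ∀ x ∈ F, ‖x‖ = 1) {c d : ℝ} (hc : 0 ≤ c) (hd : -1 < d) (hdc : d ≤ c)
    (hcov : ∀ z : E, ‖z‖ = 1 → ∃ x ∈ F, d ≤ ⟪x, z⟫) {p : E} (hp : ‖p‖ = 1) :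
    σ {z | ‖z‖ = 1} * σ (cap p c) ≤ σ (⋃ x ∈ F, cap x c) * σ (cap p d) := by
  obtain ⟨k, e, hinj, hran⟩ : ∃ (k : ℕ) (e : Fin k → E), Function.Injective e ∧
      ∀ x, x ∈ F ↔ ∃ i, e i = x := by
    refine ⟨F.card, fun i => (F.equivFin.symm i : E), ?_, ?_⟩
    · exact Subtype.val_injective.comp F.equivFin.symm.injective
    · intro x
      constructor
      · intro hx
        exact ⟨F.equivFin ⟨x, hx⟩, by simp⟩
      · rintro ⟨i, rfl⟩
        exact (F.equivFin.symm i).2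
  have he1 : ∀ i, ‖e i‖ = 1 := fun i => hF _ ((hran _).2 ⟨i, rfl⟩)
  let A : Fin k → Set E := fun i => {z | ‖z‖ = 1} ∩
    ((⋂ j, {z | ⟪e j, z⟫ ≤ ⟪e i, z⟫}) ∩ ⋂ j, ⋂ (_ : j < i), {z | ⟪e j, z⟫ < ⟪e i, z⟫})
  have hmemA : ∀ i z, z ∈ A i ↔ ‖z‖ = 1 ∧ (∀ j, ⟪e j, z⟫ ≤ ⟪e i, z⟫) ∧
      ∀ j < i, ⟪e j, z⟫ < ⟪e i, z⟫ := by
    intro i z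
    simp [A]
  have hci : ∀ i, Continuous fun z : E => ⟪e i, z⟫ := fun i =>
    continuous_const.inner continuous_id
  have hAm : ∀ i, MeasurableSet (A i) := by
    intro i
    refine (isClosed_eq continuous_norm continuous_const).measurableSet.inter
      ((MeasurableSet.iInter fun j => (isClosed_le (hci j) (hci i)).measurableSet).inter
        (MeasurableSet.iInter fun j => MeasurableSet.iInter fun _ =>
          (isOpen_lt (hci j) (hci i)).measurableSet))
  have hcover : {z : E | ‖z‖ = 1} ⊆ ⋃ i, A i := by
    intro z hz
    obtain ⟨x, hxF, -⟩ := hcov z hz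
    obtain ⟨i0, -⟩ := (hran x).1 hxF
    have hne : Nonempty (Fin k) := ⟨i0⟩
    obtain ⟨i1, hi1⟩ := Finite.exists_max (fun i => ⟪e i, z⟫)
    obtain ⟨i, hi, hmin⟩ := WellFounded.has_min (wellFounded_lt (α := Fin k))
      {i | ∀ j, ⟪e j, z⟫ ≤ ⟪e i, z⟫} ⟨i1, hi1⟩
    refine Set.mem_iUnion.2 ⟨i, (hmemA i z).2 ⟨hz, hi, fun j hj => ?_⟩⟩
    by_contra hcon
    push Not at hcon
    exact hmin j (fun l => (hi l).trans hcon) hj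
  have hdisj : Pairwise (Function.onFun Disjoint A) := by
    intro i j hij
    refine Set.disjoint_left.2 fun z hzi hzj => ?_
    rw [hmemA] at hzi hzj
    rcases lt_or_gt_of_ne hij with h | h
    · exact absurd (hzi.2.1 j) (not_le.2 (hzj.2.2 i h))
    · exact absurd (hzj.2.1 i) (not_le.2 (hzi.2.2 j h))
  have hkey : ∀ i, σ (A i) * σ (cap p c) ≤ σ (A i ∩ cap (e i) c) * σ (cap p d) := by
    intro i
    rw [← cap_measure_eq σ hinv (he1 i) hp c, ← cap_measure_eq σ hinv (he1 i) hp d]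
    refine star_ineq σ hinv (he1 i) (hAm i) hc hd hdc ?_ ?_
    · intro z hz
      rw [hmemA] at hz
      obtain ⟨x, hxF, hx⟩ := hcov z hz.1
      obtain ⟨j, rfl⟩ := (hran x).1 hxF
      exact ⟨hz.1, hx.trans (hz.2.1 j)⟩
    · intro z hz a b ha hb hab
      rw [hmemA] at hz ⊢
      have hle : ∀ j, ⟪e j, e i⟫ ≤ 1 := fun j => by
        have := real_inner_le_norm (e j) (e i)
        rwa [he1, he1, one_mul] at this
      have hii : ⟪e i, e i⟫ = 1 := by rw [real_inner_self_eq_norm_sq, he1, one_pow]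
      refine ⟨hab, fun j => ?_, fun j hj => ?_⟩
      · simp only [inner_add_right, inner_smul_right, hii]
        nlinarith [mul_le_mul_of_nonneg_left (hz.2.1 j) ha, mul_le_mul_of_nonneg_left (hle j) hb]
      · have hlt : ⟪e j, e i⟫ < 1 := by
          refine lt_of_le_of_ne (hle j) fun h => ?_
          exact hj.ne (hinj ((inner_eq_one_iff_of_norm_eq_one (he1 j) (he1 i)).1 h))
        simp only [inner_add_right, inner_smul_right, hii]
        rcases ha.eq_or_lt with h | h
        · have hb0 : 0 < b := by
            refine lt_of_le_of_ne hb fun h' => ?_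
            rw [← h, ← h'] at hab
            simp at hab
          rw [← h]
          nlinarith [mul_lt_mul_of_pos_left hlt hb0]
        · nlinarith [mul_lt_mul_of_pos_left (hz.2.2 j hj) h, mul_le_mul_of_nonneg_left (hle j) hb]
  calc σ {z | ‖z‖ = 1} * σ (cap p c) ≤ (∑ i, σ (A i)) * σ (cap p c) := by
        gcongr
        exact (measure_mono hcover).trans (measure_iUnion_fintype_le _ _)
    _ = ∑ i, σ (A i) * σ (cap p c) := Finset.sum_mul _ _ _
    _ ≤ ∑ i, σ (A i ∩ cap (e i) c) * σ (cap p d) := Finset.sum_le_sum fun i _ => hkey i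
    _ = (∑ i, σ (A i ∩ cap (e i) c)) * σ (cap p d) := (Finset.sum_mul _ _ _).symm
    _ = σ (⋃ i, A i ∩ cap (e i) c) * σ (cap p d) := by
        rw [measure_iUnion _ fun i => (hAm i).inter (cap_closed _ _).measurableSet, tsum_fintype]
        exact fun i j hij => (hdisj hij).mono Set.inter_subset_left Set.inter_subset_left
    _ ≤ _ := by
        gcongr
        refine Set.iUnion_subset fun i => Set.inter_subset_right.trans ?_
        exact Set.subset_biUnion_of_mem (u := fun x => cap x c) ((hran _).2 ⟨i, rfl⟩)

/-- version for a compact set, after passing to the limit -/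
lemma compact_cover [MeasurableSpace E] [BorelSpace E] (σ : Measure E) [IsFiniteMeasure σ]
    (hinv : ∀ g : E ≃ₗᵢ[ℝ] E, ∀ s, MeasurableSet s → σ (g ⁻¹' s) = σ s)
    (X : Set E) (hX : IsCompact X) (hX1 : ∀ x ∈ X, ‖x‖ = 1) {c : ℝ} (hc : 0 ≤ c)
    (hcov : ∀ z : E, ‖z‖ = 1 → ∃ x ∈ X, 0 ≤ ⟪x, z⟫) {p : E} (hp : ‖p‖ = 1) :
    σ {z | ‖z‖ = 1} * σ (cap p c) ≤ σ (⋃ x ∈ X, cap x c) * σ (cap p 0) := by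
  have hN : ∀ N : ℕ, σ {z | ‖z‖ = 1} * σ (cap p c) ≤
      σ (⋃ x ∈ X, cap x c) * σ (cap p (-(1 / ((N : ℝ) + 2)))) := by
    intro N
    have hδ : (0 : ℝ) < 1 / ((N : ℝ) + 2) := by positivity
    have hδ1 : 1 / ((N : ℝ) + 2) < 1 := by
      rw [div_lt_one (by positivity)]
      have : (0 : ℝ) ≤ N := Nat.cast_nonneg N
      linarith
    obtain ⟨t, htX, htf, ht⟩ := hX.finite_cover_balls hδ
    have htm : ∀ x, x ∈ htf.toFinset ↔ x ∈ t := fun x => htf.mem_toFinset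
    refine (finite_cover σ hinv htf.toFinset (fun x hx => hX1 x (htX ((htm x).1 hx))) hc
      (d := -(1 / ((N : ℝ) + 2))) (by linarith) (by linarith) ?_ hp).trans ?_
    · intro z hz
      obtain ⟨x, hx, hxz⟩ := hcov z hz
      obtain ⟨y, hy, hxy⟩ := Set.mem_iUnion₂.1 (ht hx)
      refine ⟨y, (htm y).2 hy, ?_⟩
      rw [Metric.mem_ball, dist_eq_norm] at hxy
      have h := real_inner_le_norm (x - y) z
      rw [hz, mul_one, inner_sub_left] at h
      linarith
    · refine mul_le_mul_left (measure_mono ?_) _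
      refine Set.iUnion₂_subset fun x hx => ?_
      exact Set.subset_biUnion_of_mem (u := fun x => cap x c) (htX ((htm x).1 hx))
  have hlim : Filter.Tendsto (fun N : ℕ => σ (cap p (-(1 / ((N : ℝ) + 2))))) Filter.atTop
      (nhds (σ (cap p 0))) := by
    have hI : cap p 0 = ⋂ N : ℕ, cap p (-(1 / ((N : ℝ) + 2))) := by
      ext z
      simp only [cap, Set.mem_iInter, Set.mem_ofPred_eq]
      constructor
      · intro h N
        have hδ : (0 : ℝ) < 1 / ((N : ℝ) + 2) := by positivity
        exact ⟨h.1, by linarith [h.2]⟩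
      · intro h
        refine ⟨(h 0).1, ?_⟩
        by_contra hcon
        push Not at hcon
        obtain ⟨N, hN⟩ := exists_nat_one_div_lt (neg_pos.2 hcon)
        have h2 := (h N).2
        have : 1 / ((N : ℝ) + 2) ≤ 1 / ((N : ℝ) + 1) := by
          gcongr
          norm_num
        linarith
    rw [hI]
    refine tendsto_measure_iInter_atTop (fun N => (cap_closed _ _).measurableSet.nullMeasurableSet)
      ?_ ⟨0, measure_ne_top _ _⟩
    intro M N hMN z hz
    refine ⟨hz.1, le_trans ?_ hz.2⟩
    have : (M : ℝ) ≤ N := by exact_mod_cast hMN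
    gcongr
  refine ge_of_tendsto' (ENNReal.Tendsto.const_mul hlim (Or.inr (measure_ne_top _ _))) hN

/-- the equator is a null set -/
lemma equator_null [MeasurableSpace E] [BorelSpace E] {n : ℕ} (hn : Module.finrank ℝ E = n + 1)
    {p : E} (hp : ‖p‖ = 1) : μH[(n : ℝ)] {z : E | ‖z‖ = 1 ∧ ⟪p, z⟫ = 0} = 0 := by
  have hfr : Module.finrank ℝ (ℝ ∙ p)ᗮ = n := by
    have : Fact (Module.finrank ℝ E = n + 1) := ⟨hn⟩
    exact Submodule.finrank_orthogonal_span_singleton (by rintro rfl; simp at hp)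
  have h0 : μH[(n : ℝ)] (Metric.sphere (0 : (ℝ ∙ p)ᗮ) 1) = 0 := by
    rw [← hfr]
    exact Measure.addHaar_sphere_of_ne_zero _ 0 one_ne_zero
  have himg : {z : E | ‖z‖ = 1 ∧ ⟪p, z⟫ = 0} =
      ((↑) : (ℝ ∙ p)ᗮ → E) '' (Metric.sphere (0 : (ℝ ∙ p)ᗮ) 1) := by
    ext z
    simp only [Set.mem_ofPred_eq, Set.mem_image, mem_sphere_zero_iff_norm]
    constructor
    · intro h
      exact ⟨⟨z, Submodule.mem_orthogonal_singleton_iff_inner_right.2 h.2⟩, h.1, rfl⟩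
    · rintro ⟨y, hy, rfl⟩
      exact ⟨hy, Submodule.mem_orthogonal_singleton_iff_inner_right.1 y.2⟩
  rw [himg, Isometry.hausdorffMeasure_image isometry_subtype_coe (Or.inl (Nat.cast_nonneg n)), h0]

end helpers

lemma geodist_le_iff {n : ℕ} {x y : EuclideanSpace ℝ (Fin n)} (hx : ‖x‖ = 1) (hy : ‖y‖ = 1)
    {ε : ℝ} (h0 : 0 < ε) (h1 : ε < Real.pi / 2) : geodist x y ≤ ε ↔ Real.cos ε ≤ ⟪y, x⟫ := by
  have hπ := Real.pi_pos
  have hab := abs_le.1 (abs_real_inner_le_norm x y)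
  rw [hx, hy, one_mul] at hab
  rw [real_inner_comm, geodist]
  constructor
  · intro h
    have := Real.cos_le_cos_of_nonneg_of_le_pi (Real.arccos_nonneg _) (by linarith) h
    rwa [Real.cos_arccos hab.1 hab.2] at this
  · intro h
    have := Real.arccos_le_arccos h
    rwa [Real.arccos_cos h0.le (by linarith)] at this

theorem neighborhood_of_non_hemispheric_set (n : ℕ)
    (X : Set (EuclideanSpace ℝ (Fin (n + 1))))
    (hXS : X ⊆ {x | ‖x‖ = 1}) (hXcl : IsClosed X)
    (hX : ∀ o : EuclideanSpace ℝ (Fin (n + 1)), ‖o‖ = 1 →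
      ∃ x ∈ X, Real.pi / 2 ≤ geodist o x)
    (p : EuclideanSpace ℝ (Fin (n + 1))) (hp : ‖p‖ = 1)
    (ε : ℝ) (hε : 0 < ε) :
    μH[(n : ℝ)] {x | ‖x‖ = 1 ∧ ∃ y ∈ ({p, -p} : Set (EuclideanSpace ℝ (Fin (n + 1)))),
        geodist x y ≤ ε}
      ≤ μH[(n : ℝ)] {x | ‖x‖ = 1 ∧ ∃ y ∈ X, geodist x y ≤ ε} := by
  have hcov : ∀ z : EuclideanSpace ℝ (Fin (n + 1)), ‖z‖ = 1 → ∃ x ∈ X, 0 ≤ ⟪x, z⟫ := by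
    intro z hz
    obtain ⟨x, hx, h⟩ := hX (-z) (by rwa [norm_neg])
    refine ⟨x, hx, ?_⟩
    by_contra hcon
    push Not at hcon
    have : geodist (-z) x < Real.pi / 2 := by
      rw [geodist, Real.arccos_lt_pi_div_two, inner_neg_left, real_inner_comm]
      linarith
    linarith
  rcases le_or_gt (Real.pi / 2) ε with hbig | hsmall
  · refine measure_mono fun z hz => ⟨hz.1, ?_⟩
    obtain ⟨x, hx, h⟩ := hcov z hz.1
    refine ⟨x, hx, le_trans ?_ hbig⟩
    rw [geodist, Real.arccos_le_pi_div_two, real_inner_comm]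
    exact h
  set c := Real.cos ε with hcdef
  have hc : 0 ≤ c := (Real.cos_pos_of_mem_Ioo ⟨by linarith, hsmall⟩).le
  have hR : {x | ‖x‖ = 1 ∧ ∃ y ∈ X, geodist x y ≤ ε} = ⋃ y ∈ X, cap y c := by
    ext z
    simp only [Set.mem_iUnion, Set.mem_ofPred_eq, cap, exists_prop]
    constructor
    · rintro ⟨hz, y, hy, h⟩
      exact ⟨y, hy, hz, (geodist_le_iff hz (hXS hy) hε hsmall).1 h⟩
    · rintro ⟨y, hy, hz, h⟩
      exact ⟨hz, y, hy, (geodist_le_iff hz (hXS hy) hε hsmall).2 h⟩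
  have hp' : ‖-p‖ = 1 := by rwa [norm_neg]
  have hL : {x | ‖x‖ = 1 ∧ ∃ y ∈ ({p, -p} : Set (EuclideanSpace ℝ (Fin (n + 1)))),
        geodist x y ≤ ε} ⊆ cap p c ∪ cap (-p) c := by
    rintro z ⟨hz, y, hy, h⟩
    rcases hy with rfl | hy
    · exact Or.inl ⟨hz, (geodist_le_iff hz hp hε hsmall).1 h⟩
    · rw [Set.mem_singleton_iff] at hy
      subst hy
      exact Or.inr ⟨hz, (geodist_le_iff hz hp' hε hsmall).1 h⟩
  refine (measure_mono hL).trans ?_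
  rw [hR]
  by_cases htop : μH[(n : ℝ)] (⋃ y ∈ X, cap y c) = ⊤
  · rw [htop]
    exact le_top
  let S : Set (EuclideanSpace ℝ (Fin (n + 1))) := {z | ‖z‖ = 1}
  have hScpt : IsCompact S := by
    have := isCompact_sphere (0 : EuclideanSpace ℝ (Fin (n + 1))) 1
    have h : S = Metric.sphere 0 1 := by
      ext z
      rw [mem_sphere_zero_iff_norm]
      rfl
    rwa [h]
  have hSm : MeasurableSet S := hScpt.isClosed.measurableSet
  have hXc : IsCompact X := hScpt.of_isClosed_subset hXcl hXS
  have hinv0 : ∀ g : EuclideanSpace ℝ (Fin (n + 1)) ≃ₗᵢ[ℝ] EuclideanSpace ℝ (Fin (n + 1)), ∀ s,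
      MeasurableSet s → μH[(n : ℝ)] (g ⁻¹' s) = μH[(n : ℝ)] s := fun g s _ =>
    g.toIsometryEquiv.hausdorffMeasure_preimage _ _
  have hc1 : c < 1 := by
    rw [hcdef, ← Real.cos_zero]
    exact Real.cos_lt_cos_of_nonneg_of_le_pi le_rfl (by linarith [Real.pi_pos]) hε
  have hfin : μH[(n : ℝ)] S ≠ ⊤ := by
    obtain ⟨x0, hx0, -⟩ := hcov p hp
    have hcapfin : ∀ x : EuclideanSpace ℝ (Fin (n + 1)), ‖x‖ = 1 → μH[(n : ℝ)] (cap x c) < ⊤ := by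
      intro x hx
      rw [cap_measure_eq _ hinv0 hx (hXS hx0) c]
      exact lt_of_le_of_lt (measure_mono
        (Set.subset_biUnion_of_mem (u := fun x => cap x c) hx0)) (lt_top_iff_ne_top.2 htop)
    refine (hScpt.measure_lt_top_of_nhdsWithin fun x hx => ⟨cap x c, ?_, hcapfin x hx⟩).ne
    have hopen : IsOpen {z : EuclideanSpace ℝ (Fin (n + 1)) | c < ⟪x, z⟫} :=
      isOpen_lt continuous_const (continuous_const.inner continuous_id)
    have hxin : c < ⟪x, x⟫ := by
      rw [real_inner_self_eq_norm_sq, show ‖x‖ = 1 from hx, one_pow]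
      exact hc1
    filter_upwards [self_mem_nhdsWithin, mem_nhdsWithin_of_mem_nhds (hopen.mem_nhds hxin)]
      with z hz hz2
    exact ⟨hz, le_of_lt hz2⟩
  let σ := (μH[(n : ℝ)]).restrict S
  have hσ : ∀ s, s ⊆ S → σ s = μH[(n : ℝ)] s := fun s hs => by
    simp only [σ, Measure.restrict_apply' hSm, Set.inter_eq_self_of_subset_left hs]
  have hσfin : IsFiniteMeasure σ := ⟨by
    simp only [σ, Measure.restrict_apply_univ]
    exact lt_top_iff_ne_top.2 hfin⟩
  have hinv : ∀ g : EuclideanSpace ℝ (Fin (n + 1)) ≃ₗᵢ[ℝ] EuclideanSpace ℝ (Fin (n + 1)), ∀ s,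
      MeasurableSet s → σ (g ⁻¹' s) = σ s := by
    intro g s hs
    simp only [σ, Measure.restrict_apply' hSm]
    rw [← hinv0 g _ (hs.inter hSm)]
    congr 1
    ext z
    simp [S]
  have hcapS : ∀ x d, cap x d ⊆ S := fun x d z hz => hz.1
  have hmain := compact_cover σ hinv X hXc (fun x hx => hXS hx) hc hcov hp
  rw [← hσ _ (Set.union_subset (hcapS _ _) (hcapS _ _)),
    ← hσ _ (Set.iUnion₂_subset fun x _ => hcapS x c)]
  have hStwo : σ S = 2 * σ (cap p 0) := by
    have hU : cap p 0 ∪ cap (-p) 0 = S := by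
      ext z
      constructor
      · rintro (h | h) <;> exact h.1
      · intro h
        rcases le_total 0 ⟪p, z⟫ with h' | h'
        · exact Or.inl ⟨h, h'⟩
        · refine Or.inr ⟨h, ?_⟩
          rw [inner_neg_left]
          linarith
    have hI : σ (cap p 0 ∩ cap (-p) 0) = 0 := by
      rw [hσ _ (Set.inter_subset_left.trans (hcapS _ _))]
      refine measure_mono_null ?_ (equator_null (n := n) (by simp) hp)
      rintro z ⟨h1, h2⟩
      refine ⟨h1.1, le_antisymm ?_ h1.2⟩
      have := h2.2
      rw [inner_neg_left] at this
      linarith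
    have := measure_union_add_inter (μ := σ) (cap p 0) (cap_closed (-p) 0).measurableSet
    rw [hU, hI, add_zero, cap_measure_eq σ hinv hp' hp] at this
    rw [this, two_mul]
  have hB : σ (cap p c ∪ cap (-p) c) ≤ 2 * σ (cap p c) := by
    refine (measure_union_le _ _).trans ?_
    rw [cap_measure_eq σ hinv hp' hp, two_mul]
  change σ S * _ ≤ _ at hmain
  by_cases hH : σ (cap p 0) = 0
  · rw [hH, mul_zero] at hStwo
    have : σ (cap p c ∪ cap (-p) c) = 0 :=
      measure_mono_null (Set.union_subset (hcapS _ _) (hcapS _ _)) hStwo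
    rw [this]
    exact zero_le
  · refine hB.trans ?_
    rw [hStwo] at hmain
    rw [← ENNReal.mul_le_mul_iff_left hH (measure_ne_top _ _)]
    calc _ = 2 * σ (cap p 0) * σ (cap p c) := by ring
      _ ≤ _ := hmain
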